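/- arXiv:2011.15108 — 2 statements merged into one kernel-verified Lean document; each statement's English description precedes it below -/
import Mathlib

section
/- In an algebra satisfying (Ax1)–(Ax5), the identity a ▷ (b·c) = (a ▷ b)·c holds. -/
theorem stmt4 {A : Type*} (sub rest : A → A → A)
    (ax1 : ∀ a b : A, sub a (sub b a) = a)
    (ax2 : ∀ a b : A, sub a (sub a b) = sub b (sub b a))
    (ax3 : ∀ a b c : A, sub (sub a b) c = sub (sub a c) b)
    (ax4 : ∀ a b c : A, sub (rest a c) (sub (rest a c) (rest b c)) = rest (rest a b) c)
    (ax5 : ∀ a b : A, rest (sub a (sub a b)) a = sub a (sub a b)) :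
    ∀ a b c : A, rest a (sub b (sub b c)) = sub (rest a b) (sub (rest a b) c) := by
  have sub_sub_same : ∀ a b, sub (sub b a) a = sub b a := fun a b => by
    have h := ax1 (sub b a) a
    rwa [ax1 a b] at h
  have self_sub : ∀ a b, sub (sub b a) (sub b a) = sub a a := fun a b => by
    have h := ax2 a (sub b a)
    rw [ax1 a b, sub_sub_same] at h
    exact h.symm
  have zero_eq : ∀ a b, sub a a = sub b b := fun a b => by
    rw [← self_sub a b, ← self_sub (sub b a) b, ax2 b a, self_sub, self_sub]
  have sub_zero : ∀ a b, sub a (sub b b) = a := fun a b => by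
    rw [zero_eq b a, ax1]
  have zero_sub : ∀ a b, sub (sub b b) a = sub b b := fun a b => by
    rw [zero_eq b a, sub_sub_same]
  -- `z` is the bottom element, and `x ≤ y` is expressed as `sub x y = z`
  intro a₀ b₀ c₀
  obtain ⟨z, hz⟩ : ∃ z, z = sub a₀ a₀ := ⟨_, rfl⟩
  have self : ∀ a, sub a a = z := fun a => by rw [hz, zero_eq]
  have sub_z : ∀ a, sub a z = a := fun a => by rw [← self a, sub_zero]
  have z_sub : ∀ a, sub z a = z := fun a => by rw [← self a, zero_sub]
  have sub_le : ∀ a b, sub (sub a b) a = z := fun a b => by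
    rw [ax3, self, z_sub]
  have antitone : ∀ p q r, sub r q = z → sub (sub p q) (sub p r) = z := fun p q r h => by
    rw [ax3, ax2, ax3, h, z_sub]
  have trans : ∀ x y w, sub x y = z → sub y w = z → sub x w = z := fun x y w h k => by
    have := antitone x w y k
    rwa [h, sub_z] at this
  have meet_le_left : ∀ p q, sub (sub p (sub p q)) p = z := fun p q => sub_le _ _
  have meet_le_right : ∀ p q, sub (sub p (sub p q)) q = z := fun p q => by
    rw [ax3, self]
  have meet_eq : ∀ p q, sub p q = z → sub p (sub p q) = p := fun p q h => by
    rw [h, sub_z]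
  have antisymm : ∀ p q, sub p q = z → sub q p = z → p = q := fun p q h k => by
    rw [← meet_eq p q h, ax2, meet_eq q p k]
  have meet_mono : ∀ x b c, sub x b = z →
      sub (sub x (sub x c)) (sub b (sub b c)) = z := fun x b c h => by
    rw [ax2 x c, ax2 b c]
    exact antitone _ _ _ (antitone _ _ _ h)
  have sub_meet : ∀ x b c, sub x b = z → sub x (sub b (sub b c)) = sub x c := fun x b c h => by
    apply antisymm
    · rw [ax3]
      exact meet_mono x b c h
    · exact antitone _ _ _ (meet_le_right b c)
  have rest_of_le : ∀ x a, sub x a = z → rest x a = x := fun x a h => by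
    have := ax5 a x
    rwa [ax2, meet_eq x a h] at this
  have rest_self : ∀ a, rest a a = a := fun a => rest_of_le a a (self a)
  have rest_le : ∀ a b, sub (rest a b) b = z := fun a b => by
    have h1 : ∀ c, sub (rest (rest a b) c) (rest b c) = z := fun c => by
      rw [← ax4]
      exact meet_le_right _ _
    have h2 := ax4 (rest a b) b (rest a b)
    rw [meet_eq _ _ (h1 _), rest_self] at h2
    have h3 := ax4 a b b
    rw [rest_self] at h3
    have h5 : rest (rest a b) b = sub (rest a b) (sub (rest a b) b) := h3.symm
    rw [h5, rest_of_le _ _ (meet_le_left _ _)] at h2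
    have h6 := meet_le_right (rest a b) b
    rwa [← h2] at h6
  have rest_restrict : ∀ a p q, sub p q = z →
      rest a p = sub (rest a q) (sub (rest a q) p) := fun a p q h => by
    have h1 := ax4 a p q
    rw [rest_of_le p q h, rest_of_le _ q (trans _ _ _ (rest_le a p) h)] at h1
    exact h1.symm
  rw [rest_restrict a₀ _ b₀ (meet_le_left b₀ c₀), sub_meet _ _ _ (rest_le a₀ b₀)]
end

section
/- In an algebra satisfying (Ax1)–(Ax5), the identity (a ▷ b) - c = a ▷ (b - c) holds. -/
section SubtractionAlgebra

variable {A : Type*} {sub : A → A → A}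

theorem sub_sub_right_self (ax1 : ∀ a b : A, sub a (sub b a) = a) (a b : A) :
    sub (sub a b) b = sub a b := by
  have h := ax1 (sub a b) b
  rwa [ax1 b a] at h

theorem sub_self_eq_sub_self (ax1 : ∀ a b : A, sub a (sub b a) = a)
    (ax2 : ∀ a b : A, sub a (sub a b) = sub b (sub b a))
    (ax3 : ∀ a b c : A, sub (sub a b) c = sub (sub a c) b) (a b : A) :
    sub a a = sub b b := by
  have meet_zero : ∀ a b : A, sub b (sub b (sub a a)) = sub a a := by
    intro a b
    rw [ax2 b, ax3 a a b, ax3 a a, ax1]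
  have zero_sub_zero : ∀ a b : A, sub (sub a a) (sub b b) = sub a a := by
    intro a b
    have h := ax3 b (sub b (sub a a)) (sub b b)
    rwa [meet_zero, ax1 b b, meet_zero] at h
  have h := ax2 (sub a a) (sub b b)
  rwa [zero_sub_zero a b, zero_sub_zero b a, zero_sub_zero, zero_sub_zero] at h

theorem eq_of_sub_eq_sub_self (ax1 : ∀ a b : A, sub a (sub b a) = a)
    (ax2 : ∀ a b : A, sub a (sub a b) = sub b (sub b a)) {a b : A}
    (hab : sub a b = sub a a) (hba : sub b a = sub b b) : a = b := by
  have h := ax2 a b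
  rwa [hab, hba, ax1, ax1] at h

theorem sub_right_sub_sub_right (ax1 : ∀ a b : A, sub a (sub b a) = a)
    (ax2 : ∀ a b : A, sub a (sub a b) = sub b (sub b a))
    (ax3 : ∀ a b c : A, sub (sub a b) c = sub (sub a c) b) (a b c : A) :
    sub (sub a c) (sub b c) = sub (sub a c) b := by
  have self := sub_self_eq_sub_self ax1 ax2 ax3
  have zero_sub : ∀ x y : A, sub (sub x x) y = sub x x := by
    intro x y
    rw [self x y, sub_sub_right_self ax1]
  obtain ⟨u, hu⟩ : ∃ u, u = sub a c := ⟨_, rfl⟩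
  have huc : sub u c = u := by rw [hu, sub_sub_right_self ax1]
  rw [← hu]
  apply eq_of_sub_eq_sub_self ax1 ax2
  · rw [self _ c]
    have disjoint : sub (sub (sub u (sub b c)) (sub u b)) c
        = sub (sub u (sub b c)) (sub u b) := by
      rw [ax3 _ (sub u b) c, ax3 u (sub b c) c, huc]
    have below : sub (sub (sub u (sub b c)) (sub u b)) c = sub c c := by
      rw [ax3 u (sub b c) (sub u b), ax2 u b, ax3 b (sub b u) (sub b c), ax2 b c,
        ax3 _ (sub b u) c, ax3 c (sub c b) c, zero_sub, zero_sub]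
    rw [← disjoint, below]
  · rw [self _ u, ax3 u b, ax2 u, ax3 _ _ b, ax3 b c b, zero_sub, zero_sub, self b u]

theorem inf_sub_sub_left (ax1 : ∀ a b : A, sub a (sub b a) = a)
    (ax2 : ∀ a b : A, sub a (sub a b) = sub b (sub b a))
    (ax3 : ∀ a b c : A, sub (sub a b) c = sub (sub a c) b) (b c d : A) :
    sub b (sub b (sub (sub b c) d)) = sub (sub b c) d := by
  have self := sub_self_eq_sub_self ax1 ax2 ax3
  have zero_sub : ∀ x y : A, sub (sub x x) y = sub x x := by
    intro x y
    rw [self x y, sub_sub_right_self ax1]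
  rw [ax2 b, ax3 (sub b c) d b, ax3 b c b, zero_sub, zero_sub,
    self b (sub (sub b c) d), ax1]

theorem inf_sub_left (ax1 : ∀ a b : A, sub a (sub b a) = a)
    (ax2 : ∀ a b : A, sub a (sub a b) = sub b (sub b a))
    (ax3 : ∀ a b c : A, sub (sub a b) c = sub (sub a c) b) (b c : A) :
    sub b (sub b (sub b c)) = sub b c := by
  have h := inf_sub_sub_left ax1 ax2 ax3 b c c
  rwa [sub_sub_right_self ax1] at h

theorem inf_sub_eq_sub_of_le (ax1 : ∀ a b : A, sub a (sub b a) = a)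
    (ax2 : ∀ a b : A, sub a (sub a b) = sub b (sub b a))
    (ax3 : ∀ a b c : A, sub (sub a b) c = sub (sub a c) b) {x b : A}
    (h : sub b (sub b x) = x) (c : A) :
    sub x (sub x (sub b c)) = sub x c := by
  rw [ax2 x, ax3 b c x, sub_right_sub_sub_right ax1 ax2 ax3, ax3 b c, h]

end SubtractionAlgebra

theorem stmt5 {A : Type*} (sub rest : A → A → A)
    (ax1 : ∀ a b : A, sub a (sub b a) = a)
    (ax2 : ∀ a b : A, sub a (sub a b) = sub b (sub b a))
    (ax3 : ∀ a b c : A, sub (sub a b) c = sub (sub a c) b)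
    (ax4 : ∀ a b c : A, sub (rest a c) (sub (rest a c) (rest b c)) = rest (rest a b) c)
    (ax5 : ∀ a b : A, rest (sub a (sub a b)) a = sub a (sub a b)) :
    ∀ a b c : A, sub (rest a b) c = rest a (sub b c) := by
  have rest_self : ∀ a : A, rest a a = a := by
    intro a
    have h := ax5 a a
    rwa [ax1] at h
  have rest_of_le : ∀ x b : A, sub b (sub b x) = x → rest x b = x := by
    intro x b h
    have h' := ax5 b x
    rwa [h] at h'
  have rest_le : ∀ a b : A, sub b (sub b (rest a b)) = rest a b := by
    intro a b
    have h1 := ax4 a b (rest a b)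
    have h2 := ax4 a b b
    have h3 := ax4 (rest a b) b (rest a b)
    have h4 := ax5 (rest a b) b
    generalize rest a b = e at *
    rw [rest_self] at h1 h2 h3
    rw [← h2, h4, h2] at h3
    have h5 := inf_sub_left ax1 ax2 ax3 (rest b e) (sub (rest b e) (rest a e))
    rw [ax2 (rest b e) (rest a e), h1, ax2] at h5
    rw [ax2, h2, ← h3, h5]
  intro a b c
  have h := ax4 a (sub b c) b
  have hle : sub b (sub b (rest a (sub b c))) = rest a (sub b c) := by
    rw [← rest_le a (sub b c), inf_sub_sub_left ax1 ax2 ax3]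
  rw [rest_of_le _ _ (inf_sub_left ax1 ax2 ax3 b c), rest_of_le _ _ hle,
    inf_sub_eq_sub_of_le ax1 ax2 ax3 (rest_le a b)] at h
  exact h
end
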